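/- Let b be a positive integer. For every s ∈ ℂ with Re(s) > b, one has G_q^{(0,b)}(s) = ζ_q(s) (in particular all the series occurring in the recursive definition of G_q^{(0,b)}(s) converge). -/

import Mathlib

open Complex

/-- The `q`-analogue `[n]_q = (1 - q^n)/(1 - q)` of a natural number `n`. -/
noncomputable def qnum (q : ℝ) (n : ℕ) : ℝ := (1 - q ^ n) / (1 - q)

/-- The general term `∏_j q^{(s_j−1)n_j}/[n_j]_q^{s_j}` of the `q`-multiple zeta series. -/
noncomputable def zetaTerm (q : ℝ) {r : ℕ} (s : Fin r → ℂ) (n : Fin r → ℕ) : ℂ :=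
  ∏ j, (q : ℂ) ^ ((s j - 1) * (n j : ℂ)) / ((qnum q (n j) : ℂ) ^ (s j))

/-- Strictly increasing `r`-tuples of positive integers `0 < n₁ < ⋯ < n_r`. -/
def qIdx (r : ℕ) : Type := {n : Fin r → ℕ // StrictMono n ∧ ∀ j, 0 < n j}

/-- The `q`-multiple zeta function of depth `r`, given by its series. -/
noncomputable def qMZF (q : ℝ) {r : ℕ} (s : Fin r → ℂ) : ℂ :=
  ∑' n : qIdx r, zetaTerm q s n.1

/-- `Gq q b a sv s` is the function `G_q^{(a,b)}(s₁,…,s_a; s)`, defined inductively by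
`G_q^{(a,1)}(s₁,…,s_a;s) = ζ_q(s₁,…,s_a,s)` and, for `b ≥ 2`,
`G_q^{(a,b)}(s₁,…,s_a;s) = Σ_{n≥0} G_q^{(a+1,b−1)}(s₁,…,s_a,s−n−b;n+b)
  − Σ_{n≥0} G_q^{(a+1,b−1)}(s₁,…,s_a,−n;s+n)`. -/
noncomputable def Gq (q : ℝ) : (b : ℕ) → (a : ℕ) → (Fin a → ℂ) → ℂ → ℂ
  | 0, _, _, _ => 0
  | 1, _a, sv, s => qMZF q (Fin.snoc sv s)
  | (b + 2), a, sv, s =>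
      (∑' n : ℕ, Gq q (b + 1) (a + 1)
          (Fin.snoc sv (s - (n : ℂ) - ((b : ℂ) + 2))) ((n : ℂ) + ((b : ℂ) + 2))) -
      ∑' n : ℕ, Gq q (b + 1) (a + 1) (Fin.snoc sv (-(n : ℂ))) (s + (n : ℂ))

/-- The assertion that all series occurring in the recursive definition of
`G_q^{(a,b)}(s₁,…,s_a;s)` converge (absolutely). -/
def GqSummable (q : ℝ) : (b : ℕ) → (a : ℕ) → (Fin a → ℂ) → ℂ → Prop
  | 0, _, _, _ => True
  | 1, a, sv, s => Summable (fun n : qIdx (a + 1) => zetaTerm q (Fin.snoc sv s) n.1)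
  | (b + 2), a, sv, s =>
      (∀ n : ℕ, GqSummable q (b + 1) (a + 1)
          (Fin.snoc sv (s - (n : ℂ) - ((b : ℂ) + 2))) ((n : ℂ) + ((b : ℂ) + 2))) ∧
      (∀ n : ℕ, GqSummable q (b + 1) (a + 1) (Fin.snoc sv (-(n : ℂ))) (s + (n : ℂ))) ∧
      Summable (fun n : ℕ => Gq q (b + 1) (a + 1)
          (Fin.snoc sv (s - (n : ℂ) - ((b : ℂ) + 2))) ((n : ℂ) + ((b : ℂ) + 2))) ∧
      Summable (fun n : ℕ => Gq q (b + 1) (a + 1) (Fin.snoc sv (-(n : ℂ))) (s + (n : ℂ)))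

/-- The ratio `q^n/[n]_q`. -/
noncomputable def qratio (q : ℝ) (n : ℕ) : ℝ := q ^ n / qnum q n

/-- The depth-one factor `q^{(s-1)n}/[n]_q^s`. -/
noncomputable def zetaFactor (q : ℝ) (n : ℕ) (s : ℂ) : ℂ :=
  (q : ℂ) ^ ((s - 1) * (n : ℂ)) / ((qnum q n : ℂ) ^ s)

/-- The complete homogeneous symmetric polynomial of degree `r` in the `len` consecutive
values `u j, u (j + 1), …, u (j + len - 1)`. -/
def consecHomog (u : ℕ → ℝ) : (r : ℕ) → (j : ℕ) → (len : ℕ) → ℝ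
  | 0, _, _ => 1
  | _ + 1, _, 0 => 0
  | r + 1, j, len + 1 =>
      consecHomog u (r + 1) (j + 1) len + u j * consecHomog u r j (len + 1)
termination_by r _ len => (r, len)

section consecHomog

variable (u : ℕ → ℝ)

lemma consecHomog_zero (j len : ℕ) : consecHomog u 0 j len = 1 := by
  rw [consecHomog]

lemma consecHomog_succ_zero (r j : ℕ) : consecHomog u (r + 1) j 0 = 0 := by
  rw [consecHomog]

lemma consecHomog_succ_succ (r j len : ℕ) :
    consecHomog u (r + 1) j (len + 1) =
      consecHomog u (r + 1) (j + 1) len + u j * consecHomog u r j (len + 1) := by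
  rw [consecHomog]

lemma consecHomog_succ_succ' (r j len : ℕ) :
    consecHomog u (r + 1) j (len + 1) =
      consecHomog u (r + 1) j len + u (j + len) * consecHomog u r j (len + 1) := by
  induction r generalizing j len with
  | zero =>
    induction len generalizing j with
    | zero => simp [consecHomog_succ_succ, consecHomog_succ_zero]
    | succ len ih =>
      rw [consecHomog_succ_succ, ih, consecHomog_succ_succ u 0 j len]
      simp only [consecHomog_zero, show j + 1 + len = j + (len + 1) by ring]
      ring
  | succ r ihr =>
    induction len generalizing j with
    | zero =>
      simp [consecHomog_succ_succ, consecHomog_succ_zero]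
    | succ len ih =>
      have h1 := consecHomog_succ_succ u r j (len + 1)
      have h2 := ihr j (len + 1)
      rw [consecHomog_succ_succ, ih, consecHomog_succ_succ u (r + 1) j len,
        show j + 1 + len = j + (len + 1) by ring]
      linear_combination u j * h2 - u (j + (len + 1)) * h1

lemma sub_mul_consecHomog (r j len : ℕ) :
    (u j - u (j + len)) * consecHomog u r j (len + 1) =
      consecHomog u (r + 1) j len - consecHomog u (r + 1) (j + 1) len := by
  linear_combination consecHomog_succ_succ' u r j len - consecHomog_succ_succ u r j len

lemma consecHomog_one (r j : ℕ) : consecHomog u r j 1 = u j ^ r := by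
  induction r with
  | zero => rw [consecHomog_zero, pow_zero]
  | succ r ih => rw [consecHomog_succ_succ, consecHomog_succ_zero, ih]; ring

variable {u}

lemma consecHomog_nonneg (hu : ∀ n, 0 ≤ u n) (r j len : ℕ) : 0 ≤ consecHomog u r j len := by
  induction r generalizing j len with
  | zero => simp [consecHomog_zero]
  | succ r ihr =>
    induction len generalizing j with
    | zero => simp [consecHomog_succ_zero]
    | succ len ih =>
      rw [consecHomog_succ_succ]
      exact add_nonneg (ih _) (mul_nonneg (hu _) (ihr _ _))

lemma consecHomog_succ_le_and_le {q : ℝ} (hq0 : 0 < q) (hq1 : q < 1) (hu : ∀ n, 0 ≤ u n)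
    (huq : ∀ n, u n ≤ q ^ n) (r j len : ℕ) :
    consecHomog u (r + 1) j len ≤ (1 - q)⁻¹ ^ (r + 1) * q ^ j ∧
      consecHomog u r j len ≤ (1 - q)⁻¹ ^ r := by
  have h1 : 0 < 1 - q := by linarith
  have key (r : ℕ) (hr : ∀ j len, consecHomog u r j len ≤ (1 - q)⁻¹ ^ r) (j len : ℕ) :
      consecHomog u (r + 1) j len ≤ (1 - q)⁻¹ ^ (r + 1) * q ^ j := by
    induction len generalizing j with
    | zero => rw [consecHomog_succ_zero]; positivity
    | succ len ih =>
      rw [consecHomog_succ_succ]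
      calc _ ≤ (1 - q)⁻¹ ^ (r + 1) * q ^ (j + 1) + q ^ j * (1 - q)⁻¹ ^ r :=
            add_le_add (ih _) (mul_le_mul (huq j) (hr _ _) (consecHomog_nonneg hu _ _ _)
              (by positivity))
        _ = (1 - q)⁻¹ ^ r * q ^ j * ((1 - q)⁻¹ * (1 - q) + (1 - q)⁻¹ * q) := by
          rw [inv_mul_cancel₀ h1.ne']; ring
        _ = _ := by ring
  have h2 : ∀ j len, consecHomog u r j len ≤ (1 - q)⁻¹ ^ r := by
    induction r with
    | zero => simp [consecHomog_zero]
    | succ r ih =>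
      intro j len
      exact (key r ih j len).trans
        (mul_le_of_le_one_right (by positivity) (pow_le_one₀ hq0.le hq1.le))
  exact ⟨key r h2 j len, h2 j len⟩

lemma tendsto_consecHomog {q : ℝ} (hq0 : 0 < q) (hq1 : q < 1) (hu : ∀ n, 0 ≤ u n)
    (huq : ∀ n, u n ≤ q ^ n) (r len : ℕ) :
    Filter.Tendsto (fun j => consecHomog u (r + 1) j len) Filter.atTop (nhds 0) := by
  have h := (tendsto_pow_atTop_nhds_zero_of_lt_one hq0.le hq1).const_mul ((1 - q)⁻¹ ^ (r + 1))
  rw [mul_zero] at h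
  exact squeeze_zero (fun j => consecHomog_nonneg hu _ _ _)
    (fun j => (consecHomog_succ_le_and_le hq0 hq1 hu huq r j len).1) h

lemma hasSum_sub_mul_consecHomog {q : ℝ} (hq0 : 0 < q) (hq1 : q < 1) (hu : ∀ n, 0 ≤ u n)
    (huq : ∀ n, u n ≤ q ^ n) (hanti : ∀ i j, 1 ≤ i → u (i + j) ≤ u i) (r len : ℕ) :
    HasSum (fun j => (u (j + 1) - u (j + 1 + len)) * consecHomog u r (j + 1) (len + 1))
      (consecHomog u (r + 1) 1 len) := by
  rw [hasSum_iff_tendsto_nat_of_nonneg fun j => mul_nonneg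
    (sub_nonneg.2 (hanti _ _ (by omega))) (consecHomog_nonneg hu _ _ _)]
  simp_rw [sub_mul_consecHomog]
  have h (n : ℕ) : ∑ i ∈ Finset.range n, (consecHomog u (r + 1) (i + 1) len -
      consecHomog u (r + 1) (i + 1 + 1) len) =
      consecHomog u (r + 1) 1 len - consecHomog u (r + 1) (n + 1) len :=
    Finset.sum_range_sub' (fun i => consecHomog u (r + 1) (i + 1) len) n
  simp_rw [h]
  simpa using ((tendsto_consecHomog hq0 hq1 hu huq r len).comp
    (Filter.tendsto_add_atTop_nat 1)).const_sub (consecHomog u (r + 1) 1 len)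

variable (u) in
lemma sum_antidiagonal_mul_consecHomog (r p d : ℕ) :
    ∑ x ∈ Finset.HasAntidiagonal.antidiagonal d,
      u (x.2 + 1) * consecHomog u r (x.2 + 1) (p + x.1 + 2) =
      consecHomog u (r + 1) 1 (p + d + 2) - consecHomog u (r + 1) (d + 2) (p + 1) := by
  induction d generalizing p with
  | zero => simp [consecHomog_succ_succ u r 1 (p + 1)]
  | succ d ih =>
    have h := ih (p + 1)
    have h' := consecHomog_succ_succ u r (d + 2) (p + 1)
    simp only [show ∀ x, p + 1 + x + 2 = p + (x + 1) + 2 by intro x; ring] at h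
    rw [Finset.Nat.sum_antidiagonal_succ, h]
    simp only [add_zero]
    linear_combination -h'

end consecHomog

section qratio

variable {q : ℝ}

lemma one_le_qnum (hq0 : 0 < q) (hq1 : q < 1) {n : ℕ} (hn : 1 ≤ n) : 1 ≤ qnum q n := by
  rw [qnum, one_le_div (by linarith)]
  have := pow_le_of_le_one hq0.le hq1.le (n := n) (by omega)
  linarith

lemma qnum_pos (hq0 : 0 < q) (hq1 : q < 1) {n : ℕ} (hn : 1 ≤ n) : 0 < qnum q n :=
  zero_lt_one.trans_le (one_le_qnum hq0 hq1 hn)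

lemma qratio_pos (hq0 : 0 < q) (hq1 : q < 1) {n : ℕ} (hn : 1 ≤ n) : 0 < qratio q n :=
  div_pos (by positivity) (qnum_pos hq0 hq1 hn)

lemma qratio_zero : qratio q 0 = 0 := by simp [qratio, qnum]

lemma qratio_nonneg (hq0 : 0 < q) (hq1 : q < 1) (n : ℕ) : 0 ≤ qratio q n := by
  rcases Nat.eq_zero_or_pos n with rfl | hn
  · exact qratio_zero.ge
  · exact (qratio_pos hq0 hq1 hn).le

lemma qratio_le_pow (hq0 : 0 < q) (hq1 : q < 1) (n : ℕ) : qratio q n ≤ q ^ n := by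
  rcases Nat.eq_zero_or_pos n with rfl | hn
  · simp [qratio_zero]
  · exact div_le_self (by positivity) (one_le_qnum hq0 hq1 hn)

lemma qratio_add_le (hq0 : 0 < q) (hq1 : q < 1) {l : ℕ} (hl : 1 ≤ l) (j : ℕ) :
    qratio q (l + j) ≤ q ^ j * qratio q l := by
  have h : qnum q l ≤ qnum q (l + j) := by
    have := pow_le_pow_of_le_one hq0.le hq1.le (show l ≤ l + j by omega)
    exact div_le_div_of_nonneg_right (by linarith) (by linarith)
  rw [qratio, qratio, ← mul_div_assoc, ← pow_add, add_comm j l]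
  exact div_le_div_of_nonneg_left (by positivity) (qnum_pos hq0 hq1 hl) h

lemma qratio_anti (hq0 : 0 < q) (hq1 : q < 1) (l j : ℕ) (hl : 1 ≤ l) :
    qratio q (l + j) ≤ qratio q l :=
  (qratio_add_le hq0 hq1 hl j).trans
    (mul_le_of_le_one_left (qratio_nonneg hq0 hq1 l) (pow_le_one₀ hq0.le hq1.le))

lemma qratio_add_lt (hq0 : 0 < q) (hq1 : q < 1) {l : ℕ} (hl : 1 ≤ l) (j : ℕ) :
    qratio q (l + j + 1) < qratio q l :=
  (qratio_add_le hq0 hq1 hl (j + 1)).trans_lt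
    (mul_lt_of_lt_one_left (qratio_pos hq0 hq1 hl) (pow_lt_one₀ hq0.le hq1 (by omega)))

lemma qratio_mul_div_sub (hq0 : 0 < q) (hq1 : q < 1) {l : ℕ} (hl : 1 ≤ l) (j : ℕ) :
    qratio q (l + j + 1) * (qratio q l / (qratio q l - qratio q (l + j + 1))) =
      q ^ l * qratio q (j + 1) := by
  have h1 : 1 - q ≠ 0 := by linarith
  have hA : 1 - q ^ l ≠ 0 := by linarith [pow_lt_one₀ hq0.le hq1 (n := l) (by omega)]
  have hB : 1 - q ^ (j + 1) ≠ 0 := by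
    linarith [pow_lt_one₀ hq0.le hq1 (n := j + 1) (by omega)]
  have hAB : 1 - q ^ l * q ^ (j + 1) ≠ 0 := by
    rw [← pow_add]
    linarith [pow_lt_one₀ hq0.le hq1 (n := l + (j + 1)) (by omega)]
  have hd : qratio q l - qratio q (l + j + 1) ≠ 0 :=
    (sub_pos.2 (qratio_add_lt hq0 hq1 hl j)).ne'
  rw [← mul_div_assoc, div_eq_iff hd]
  simp only [qratio, qnum, add_assoc, pow_add q l]
  field_simp
  ring

lemma qratio_mul_div_sub' (hq0 : 0 < q) (hq1 : q < 1) {l : ℕ} (hl : 1 ≤ l) (j : ℕ) :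
    q ^ l * qratio q (j + 1) * qratio q (l + j + 1) =
      qratio q l * q ^ (l + j + 1) * (qratio q (j + 1) - qratio q (l + j + 1)) := by
  have h1 : 1 - q ≠ 0 := by linarith
  have hA : 1 - q ^ l ≠ 0 := by linarith [pow_lt_one₀ hq0.le hq1 (n := l) (by omega)]
  have hB : 1 - q ^ (j + 1) ≠ 0 := by
    linarith [pow_lt_one₀ hq0.le hq1 (n := j + 1) (by omega)]
  have hAB : 1 - q ^ l * q ^ (j + 1) ≠ 0 := by
    rw [← pow_add]
    linarith [pow_lt_one₀ hq0.le hq1 (n := l + (j + 1)) (by omega)]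
  simp only [qratio, qnum, add_assoc, pow_add q l]
  field_simp
  ring

end qratio

section zetaFactor

variable {q : ℝ}

lemma zetaFactor_eq (hq0 : 0 < q) (hq1 : q < 1) {n : ℕ} (hn : 1 ≤ n) (s : ℂ) :
    zetaFactor q n s = ((q : ℂ) ^ n)⁻¹ * (qratio q n : ℂ) ^ s := by
  have hQ := qnum_pos hq0 hq1 hn
  have hq : (q : ℂ) ≠ 0 := by exact_mod_cast hq0.ne'
  have hu : (qratio q n : ℂ) ≠ 0 := by exact_mod_cast (qratio_pos hq0 hq1 hn).ne'
  have hQ' : (qnum q n : ℂ) ≠ 0 := by exact_mod_cast hQ.ne'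
  have hlog : Real.log (qratio q n) = n * Real.log q - Real.log (qnum q n) := by
    rw [qratio, Real.log_div (by positivity) hQ.ne', Real.log_pow]
  rw [zetaFactor, ← cpow_natCast, cpow_def_of_ne_zero hq, cpow_def_of_ne_zero hQ',
    cpow_def_of_ne_zero hu, cpow_def_of_ne_zero hq, ← ofReal_log hq0.le, ← ofReal_log hQ.le,
    ← ofReal_log (qratio_nonneg hq0 hq1 n), hlog, ← Complex.exp_sub, ← Complex.exp_neg,
    ← Complex.exp_add]
  congr 1
  push_cast
  ring

lemma norm_zetaFactor (hq0 : 0 < q) (hq1 : q < 1) {n : ℕ} (hn : 1 ≤ n) (s : ℂ) :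
    ‖zetaFactor q n s‖ = (q ^ n)⁻¹ * qratio q n ^ s.re := by
  rw [zetaFactor_eq hq0 hq1 hn, norm_mul, norm_cpow_eq_rpow_re_of_pos (qratio_pos hq0 hq1 hn),
    norm_inv, norm_pow, norm_real, Real.norm_of_nonneg hq0.le]

lemma zetaFactor_add_natCast (hq0 : 0 < q) (hq1 : q < 1) {n : ℕ} (hn : 1 ≤ n) (s : ℂ) (N : ℕ) :
    zetaFactor q n (s + N) = zetaFactor q n s * (qratio q n : ℂ) ^ N := by
  have hu : (qratio q n : ℂ) ≠ 0 := by exact_mod_cast (qratio_pos hq0 hq1 hn).ne'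
  rw [zetaFactor_eq hq0 hq1 hn, zetaFactor_eq hq0 hq1 hn, cpow_add _ _ hu, cpow_natCast]
  ring

lemma zetaFactor_shift_mul (hq0 : 0 < q) (hq1 : q < 1) {l k : ℕ} (hl : 1 ≤ l) (hk : 1 ≤ k)
    (x y : ℂ) (N : ℕ) :
    zetaFactor q l (x - N) * zetaFactor q k (y + N) =
      zetaFactor q l x * zetaFactor q k y * ((qratio q k / qratio q l : ℝ) : ℂ) ^ N := by
  have hu : (qratio q l : ℂ) ≠ 0 := by exact_mod_cast (qratio_pos hq0 hq1 hl).ne'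
  have h := zetaFactor_add_natCast hq0 hq1 hl (x - N) N
  rw [sub_add_cancel] at h
  rw [h, zetaFactor_add_natCast hq0 hq1 hk]
  push_cast
  rw [div_pow]
  field_simp

lemma hasSum_zetaFactor_shift_mul (hq0 : 0 < q) (hq1 : q < 1) {l : ℕ} (hl : 1 ≤ l) (j : ℕ)
    (x y : ℂ) :
    HasSum (fun N : ℕ => zetaFactor q l (x - N) * zetaFactor q (l + j + 1) (y + N))
      (zetaFactor q l x * zetaFactor q (l + j + 1) y *
        ((qratio q l / (qratio q l - qratio q (l + j + 1)) : ℝ) : ℂ)) := by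
  have hul := qratio_pos hq0 hq1 hl
  have hlt := qratio_add_lt hq0 hq1 hl j
  simp_rw [zetaFactor_shift_mul hq0 hq1 hl (show 1 ≤ l + j + 1 by omega)]
  have h := hasSum_geometric_of_lt_one
    (div_nonneg (qratio_nonneg hq0 hq1 (l + j + 1)) hul.le) ((div_lt_one hul).2 hlt)
  have h' := (hasSum_ofReal.2 h).mul_left (zetaFactor q l x * zetaFactor q (l + j + 1) y)
  rw [one_sub_div hul.ne', inv_div] at h'
  simpa only [ofReal_pow] using h'

lemma norm_zetaFactor_shift_mul_le (hq0 : 0 < q) (hq1 : q < 1) {l : ℕ} (hl : 1 ≤ l) (j : ℕ)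
    (x y : ℂ) (hy : 2 ≤ y.re) (N : ℕ) :
    ‖zetaFactor q l (x - N) * zetaFactor q (l + j + 1) (y + N)‖ ≤
      ‖zetaFactor q l (x + y - 1)‖ * q ^ j * q ^ N := by
  have hk : 1 ≤ l + j + 1 := by omega
  have hul := qratio_pos hq0 hq1 hl
  have huk := qratio_pos hq0 hq1 hk
  have hle : qratio q (l + j + 1) ≤ q ^ (j + 1) * qratio q l := qratio_add_le hq0 hq1 hl (j + 1)
  have hr : qratio q (l + j + 1) / qratio q l ≤ q ^ (j + 1) := (div_le_iff₀ hul).2 hle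
  have hr0 : 0 ≤ qratio q (l + j + 1) / qratio q l := by positivity
  have hrq : qratio q (l + j + 1) / qratio q l ≤ q :=
    hr.trans (pow_le_of_le_one hq0.le hq1.le (by omega))
  have hrj : (qratio q (l + j + 1) / qratio q l) ^ (y.re - 1) ≤ q ^ j := by
    calc _ ≤ (qratio q (l + j + 1) / qratio q l) ^ (1 : ℝ) :=
          Real.rpow_le_rpow_of_exponent_ge (by positivity) (hrq.trans hq1.le) (by linarith)
      _ ≤ q ^ (j + 1) := by rwa [Real.rpow_one]
      _ ≤ q ^ j := pow_le_pow_of_le_one hq0.le hq1.le (by omega)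
  have hpk : (q ^ (l + j + 1))⁻¹ * qratio q (l + j + 1) ≤ 1 := by
    rw [inv_mul_le_one₀ (by positivity)]
    exact qratio_le_pow hq0 hq1 _
  rw [zetaFactor_shift_mul hq0 hq1 hl hk, norm_mul, norm_mul, norm_pow, norm_real,
    Real.norm_of_nonneg hr0]
  refine mul_le_mul ?_ (pow_le_pow_left₀ hr0 hrq N) (by positivity) (by positivity)
  rw [norm_zetaFactor hq0 hq1 hl, norm_zetaFactor hq0 hq1 hk, norm_zetaFactor hq0 hq1 hl]
  have e1 : qratio q (l + j + 1) ^ y.re = qratio q (l + j + 1) *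
      (qratio q l ^ (y.re - 1) * (qratio q (l + j + 1) / qratio q l) ^ (y.re - 1)) := by
    rw [← Real.mul_rpow hul.le hr0, mul_div_cancel₀ _ hul.ne', ← Real.rpow_one_add' huk.le]
    · ring_nf
    · linarith
  have e2 : (x + y - 1).re = x.re + (y.re - 1) := by simp; ring
  rw [e1, e2, Real.rpow_add hul]
  calc _ = (q ^ l)⁻¹ * (qratio q l ^ x.re * qratio q l ^ (y.re - 1)) *
        (((q ^ (l + j + 1))⁻¹ * qratio q (l + j + 1)) *
          (qratio q (l + j + 1) / qratio q l) ^ (y.re - 1)) := by ring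
    _ ≤ _ := by
      refine mul_le_mul_of_nonneg_left ?_ (by positivity)
      simpa using mul_le_mul hpk hrj (by positivity) zero_le_one

lemma zetaFactor_mul_two (hq0 : 0 < q) (hq1 : q < 1) {l : ℕ} (hl : 1 ≤ l) (j : ℕ) (x : ℂ) :
    zetaFactor q l x * zetaFactor q (l + j + 1) 2 *
        ((qratio q l / (qratio q l - qratio q (l + j + 1)) : ℝ) : ℂ) =
      zetaFactor q l (x + 1) * ((qratio q (j + 1) - qratio q (l + j + 1) : ℝ) : ℂ) := by
  have hk : 1 ≤ l + j + 1 := by omega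
  have h1 := zetaFactor_add_natCast hq0 hq1 hl x 1
  have h2 := zetaFactor_add_natCast hq0 hq1 hk 0 2
  have h0 : zetaFactor q (l + j + 1) 0 = ((q : ℂ) ^ (l + j + 1))⁻¹ := by
    rw [zetaFactor_eq hq0 hq1 hk, cpow_zero, mul_one]
  simp only [Nat.cast_one, pow_one, Nat.cast_ofNat, zero_add] at h1 h2
  rw [h1, h2, h0]
  have hq : (q : ℂ) ≠ 0 := by exact_mod_cast hq0.ne'
  have e1 := congrArg (fun t : ℝ => (t : ℂ)) (qratio_mul_div_sub hq0 hq1 hl j)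
  have e2 := congrArg (fun t : ℝ => (t : ℂ)) (qratio_mul_div_sub' hq0 hq1 hl j)
  simp only [ofReal_mul (qratio q (l + j + 1))] at e1
  generalize ((qratio q l / (qratio q l - qratio q (l + j + 1)) : ℝ) : ℂ) = D at *
  have hp : (q : ℂ) ^ (l + j + 1) ≠ 0 := pow_ne_zero _ hq
  push_cast at e1 e2 ⊢
  field_simp
  linear_combination zetaFactor q l x * (qratio q (l + j + 1) * e1 + e2)

lemma zetaFactor_zero_mul (hq0 : 0 < q) (hq1 : q < 1) {l : ℕ} (hl : 1 ≤ l) (j : ℕ) (y : ℂ) :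
    zetaFactor q l 0 * zetaFactor q (l + j + 1) (y + 1) *
        ((qratio q l / (qratio q l - qratio q (l + j + 1)) : ℝ) : ℂ) =
      zetaFactor q (l + j + 1) y * (qratio q (j + 1) : ℂ) := by
  have hk : 1 ≤ l + j + 1 := by omega
  have h1 := zetaFactor_add_natCast hq0 hq1 hk y 1
  have h0 : zetaFactor q l 0 = ((q : ℂ) ^ l)⁻¹ := by
    rw [zetaFactor_eq hq0 hq1 hl, cpow_zero, mul_one]
  simp only [Nat.cast_one, pow_one] at h1
  rw [h1, h0]
  have hq : (q : ℂ) ≠ 0 := by exact_mod_cast hq0.ne'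
  have e1 := congrArg (fun t : ℝ => (t : ℂ)) (qratio_mul_div_sub hq0 hq1 hl j)
  simp only [ofReal_mul (qratio q (l + j + 1))] at e1
  generalize ((qratio q l / (qratio q l - qratio q (l + j + 1)) : ℝ) : ℂ) = D at *
  have hp : (q : ℂ) ^ l ≠ 0 := pow_ne_zero _ hq
  push_cast at e1
  field_simp
  linear_combination zetaFactor q (l + j + 1) y * e1

end zetaFactor

section qIdx

/-- The last entry of a tuple in `qIdx a`, with value `0` for the empty tuple. -/
def qIdx.last : {a : ℕ} → qIdx a → ℕ
  | 0, _ => 0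
  | a + 1, n => n.1 (Fin.last a)

lemma qIdx.le_last {a : ℕ} (n : qIdx a) (i : Fin a) : n.1 i ≤ n.last := by
  cases a with
  | zero => exact i.elim0
  | succ a => exact n.2.1.monotone (Fin.le_last i)

lemma qIdx.last_lt {a : ℕ} {n : qIdx a} {k : ℕ} (hk : 0 < k) (h : ∀ i, n.1 i < k) :
    n.last < k := by
  cases a with
  | zero => exact hk
  | succ a => exact h _

/-- Appending an entry to a tuple: `(n, j)` is sent to `(n₁, …, n_a, n_a + j + 1)`. -/
def qIdx.snocEquiv (a : ℕ) : qIdx a × ℕ ≃ qIdx (a + 1) where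
  toFun p := ⟨Fin.snoc p.1.1 (p.1.last + p.2 + 1), by
    have hlt (i : Fin a) : p.1.1 i < p.1.last + p.2 + 1 := by
      have := p.1.le_last i
      omega
    refine ⟨fun i j hij => ?_, fun j => ?_⟩
    · induction j using Fin.lastCases with
      | last =>
        induction i using Fin.lastCases with
        | last => exact absurd hij (lt_irrefl _)
        | cast i => simpa using hlt i
      | cast j =>
        induction i using Fin.lastCases with
        | last => exact absurd hij (Fin.castSucc_lt_last j).not_gt
        | cast i => simpa using p.1.2.1 (Fin.castSucc_lt_castSucc_iff.1 hij)
    · induction j using Fin.lastCases with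
      | last => simp
      | cast j => simpa using p.1.2.2 j⟩
  invFun n :=
    let m : qIdx a := ⟨Fin.init n.1, fun _ _ hij => n.2.1 (Fin.castSucc_lt_castSucc_iff.2 hij),
      fun j => n.2.2 j.castSucc⟩
    (m, n.1 (Fin.last a) - m.last - 1)
  left_inv p := by
    have h : (⟨p.1.1, p.1.2⟩ : qIdx a) = p.1 := rfl
    simp only [Fin.init_snoc, Fin.snoc_last, h]
    ext1
    · rfl
    · simp only
      omega
  right_inv n := by
    apply Subtype.ext
    set m : qIdx a := ⟨Fin.init n.1, fun _ _ hij => n.2.1 (Fin.castSucc_lt_castSucc_iff.2 hij),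
      fun j => n.2.2 j.castSucc⟩ with hm
    have hlt : m.last < n.1 (Fin.last a) :=
      qIdx.last_lt (n.2.2 _) fun i => n.2.1 (Fin.castSucc_lt_last i)
    simp only
    rw [show m.last + (n.1 (Fin.last a) - m.last - 1) + 1 = n.1 (Fin.last a) by omega]
    exact Fin.snoc_init_self n.1

lemma qIdx.coe_snocEquiv {a : ℕ} (p : qIdx a × ℕ) :
    (qIdx.snocEquiv a p).1 = Fin.snoc p.1.1 (p.1.last + p.2 + 1) := rfl

lemma qIdx.last_snocEquiv {a : ℕ} (p : qIdx a × ℕ) :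
    (qIdx.snocEquiv a p).last = p.1.last + p.2 + 1 := by
  change (qIdx.snocEquiv a p).1 (Fin.last a) = _
  rw [qIdx.coe_snocEquiv, Fin.snoc_last]

lemma zetaTerm_snocEquiv (q : ℝ) {a : ℕ} (sv : Fin a → ℂ) (s : ℂ) (p : qIdx a × ℕ) :
    zetaTerm q (Fin.snoc sv s) (qIdx.snocEquiv a p).1 =
      zetaTerm q sv p.1.1 * zetaFactor q (p.1.last + p.2 + 1) s := by
  rw [zetaTerm, Fin.prod_univ_castSucc, qIdx.coe_snocEquiv]
  simp only [Fin.snoc_castSucc, Fin.snoc_last]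
  rfl

end qIdx

section Gq

variable {q : ℝ}

/-- The terms of the single series over `n_a < k` that computes
`G_q^{(a,b+1)}(s₁,…,s_a;s)`. -/
noncomputable def GqTerm (q : ℝ) (b : ℕ) {a : ℕ} (sv : Fin a → ℂ) (s : ℂ)
    (p : qIdx a × ℕ) : ℂ :=
  zetaTerm q sv p.1.1 * zetaFactor q (p.1.last + p.2 + 1) (s - b) *
    (consecHomog (qratio q) b (p.2 + 1) (p.1.last + 1) : ℂ)

lemma norm_consecHomog_qratio_le (hq0 : 0 < q) (hq1 : q < 1) (r j len : ℕ) :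
    ‖(consecHomog (qratio q) r j len : ℂ)‖ ≤ (1 - q)⁻¹ ^ r := by
  rw [norm_real, Real.norm_of_nonneg (consecHomog_nonneg (qratio_nonneg hq0 hq1) _ _ _)]
  exact (consecHomog_succ_le_and_le hq0 hq1 (qratio_nonneg hq0 hq1) (qratio_le_pow hq0 hq1)
    r j len).2

/-- Summation over `N` of the values of `G_q^{(a+1,b+1)}` along `(x - N, y + b + N)`,
given its expression as a single series. -/
lemma exists_hasSum_Gq_shift (hq0 : 0 < q) (hq1 : q < 1) {b a : ℕ}
    (ih : ∀ (sv : Fin (a + 1) → ℂ) (s : ℂ), (b : ℝ) + 1 < s.re →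
      Summable (fun p : qIdx (a + 1) × ℕ =>
        zetaTerm q sv p.1.1 * zetaFactor q (p.1.last + p.2 + 1) (s - b)) →
      GqSummable q (b + 1) (a + 1) sv s ∧ HasSum (GqTerm q b sv s) (Gq q (b + 1) (a + 1) sv s))
    (sv : Fin a → ℂ) (x y : ℂ) (hy : 2 ≤ y.re)
    (hsum : Summable (fun p : qIdx a × ℕ =>
      zetaTerm q sv p.1.1 * zetaFactor q (p.1.last + p.2 + 1) (x + y - 1)))
    {X Y : ℕ → ℂ} (hX : ∀ N, X N = x - N) (hY : ∀ N, Y N = y + N + b) :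
    (∀ N, GqSummable q (b + 1) (a + 1) (Fin.snoc sv (X N)) (Y N)) ∧
    ∃ S, HasSum (fun N => Gq q (b + 1) (a + 1) (Fin.snoc sv (X N)) (Y N)) S ∧
      HasSum (fun p : (qIdx a × ℕ) × ℕ => zetaTerm q sv p.1.1.1 *
        (zetaFactor q (p.1.1.last + p.1.2 + 1) x *
          zetaFactor q (p.1.1.last + p.1.2 + 1 + p.2 + 1) y *
          ((qratio q (p.1.1.last + p.1.2 + 1) / (qratio q (p.1.1.last + p.1.2 + 1) -
            qratio q (p.1.1.last + p.1.2 + 1 + p.2 + 1)) : ℝ) : ℂ)) *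
        (consecHomog (qratio q) b (p.2 + 1) (p.1.1.last + p.1.2 + 1 + 1) : ℂ)) S := by
  set F₀ : ℕ × ((qIdx a × ℕ) × ℕ) → ℂ := fun r => zetaTerm q sv r.2.1.1.1 *
    (zetaFactor q (r.2.1.1.last + r.2.1.2 + 1) (x - r.1) *
      zetaFactor q (r.2.1.1.last + r.2.1.2 + 1 + r.2.2 + 1) (y + r.1)) with hF₀
  set F : ℕ × ((qIdx a × ℕ) × ℕ) → ℂ := fun r => F₀ r *
    (consecHomog (qratio q) b (r.2.2 + 1) (r.2.1.1.last + r.2.1.2 + 1 + 1) : ℂ) with hF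
  have hgeo : Summable (fun n : ℕ => q ^ n) := summable_geometric_of_lt_one hq0.le hq1
  have hF₀s : Summable (fun r => ‖F₀ r‖) := by
    have h := hgeo.mul_of_nonneg (hsum.norm.mul_of_nonneg hgeo (fun _ => norm_nonneg _)
      fun _ => by positivity) (fun _ => by positivity) fun _ => by positivity
    refine h.of_nonneg_of_le (fun _ => norm_nonneg _) fun r => ?_
    rw [hF₀, norm_mul]
    refine (mul_le_mul_of_nonneg_left (norm_zetaFactor_shift_mul_le hq0 hq1 (by omega) _ x y hy
      _) (norm_nonneg _)).trans (le_of_eq ?_)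
    rw [norm_mul]
    ring
  have hFs : Summable F := by
    refine (hF₀s.mul_right ((1 - q)⁻¹ ^ b)).of_norm_bounded fun r => ?_
    rw [hF, norm_mul]
    exact mul_le_mul_of_nonneg_left (norm_consecHomog_qratio_le hq0 hq1 _ _ _) (norm_nonneg _)
  let e : (qIdx a × ℕ) × ℕ ≃ qIdx (a + 1) × ℕ :=
    (qIdx.snocEquiv a).prodCongr (Equiv.refl ℕ)
  have he (p) : e p = (qIdx.snocEquiv a p.1, p.2) := rfl
  have hYre (N) : (b : ℝ) + 1 < (Y N).re := by
    rw [hY]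
    simp only [add_re, natCast_re]
    have : (0 : ℝ) ≤ N := N.cast_nonneg
    linarith
  have hlevel (N) : GqSummable q (b + 1) (a + 1) (Fin.snoc sv (X N)) (Y N) ∧
      HasSum (fun p => F (N, p)) (Gq q (b + 1) (a + 1) (Fin.snoc sv (X N)) (Y N)) := by
    have hYb : Y N - b = y + N := by rw [hY]; ring
    have h := ih (Fin.snoc sv (X N)) (Y N) (hYre N) (by
      rw [← e.summable_iff]
      refine (summable_congr fun p => ?_).2 (hF₀s.of_norm.prod_factor N)
      simp only [Function.comp, he, zetaTerm_snocEquiv, qIdx.last_snocEquiv, hF₀, hYb, hX]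
      ring)
    refine ⟨h.1, ?_⟩
    refine HasSum.congr_fun (e.hasSum_iff.2 h.2) fun p => ?_
    simp only [Function.comp, he, GqTerm, zetaTerm_snocEquiv, qIdx.last_snocEquiv, hF, hF₀, hYb,
      hX]
    ring
  refine ⟨fun N => (hlevel N).1, ∑' r, F r,
    hFs.hasSum.prod_fiberwise fun N => (hlevel N).2, ?_⟩
  have hswap : HasSum (fun r : ((qIdx a × ℕ) × ℕ) × ℕ => F (r.2, r.1)) (∑' r, F r) :=
    (Equiv.prodComm ((qIdx a × ℕ) × ℕ) ℕ).hasSum_iff.2 hFs.hasSum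
  refine hswap.prod_fiberwise fun p => ?_
  have h := hasSum_zetaFactor_shift_mul hq0 hq1
    (show 1 ≤ p.1.1.last + p.1.2 + 1 by omega) p.2 x y
  exact (h.mul_left (zetaTerm q sv p.1.1.1)).mul_right
    (consecHomog (qratio q) b (p.2 + 1) (p.1.1.last + p.1.2 + 1 + 1) : ℂ)

/-- Grouping the terms of a series indexed by `(n, i), j` according to `n` and `i + j`. -/
lemma HasSum.antidiagonal_fiberwise {X : Type*} {f : (X × ℕ) × ℕ → ℂ} {S : ℂ} (h : HasSum f S) :
    HasSum (fun p : X × ℕ => ∑ x ∈ Finset.HasAntidiagonal.antidiagonal p.2, f ((p.1, x.1), x.2))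
      S := by
  have h' : HasSum (fun r : Σ p : X × ℕ, Finset.HasAntidiagonal.antidiagonal p.2 =>
      f ((r.1.1, r.2.1.1), r.2.1.2)) S := by
    let e : (Σ p : X × ℕ, Finset.HasAntidiagonal.antidiagonal p.2) ≃ (X × ℕ) × ℕ :=
      { toFun := fun r => ((r.1.1, r.2.1.1), r.2.1.2)
        invFun := fun r => ⟨(r.1.1, r.1.2 + r.2), (r.1.2, r.2), by simp⟩
        left_inv := by
          rintro ⟨⟨x, d⟩, ⟨i, j⟩, hij⟩
          obtain rfl : i + j = d := by simpa using hij
          rfl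
        right_inv := fun _ => rfl }
    exact e.hasSum_iff.2 h
  refine h'.sigma fun p => ?_
  rw [← Finset.sum_coe_sort]
  exact hasSum_fintype _

lemma hasSum_GqTerm_sub (hq0 : 0 < q) (hq1 : q < 1) {b a : ℕ} (sv : Fin a → ℂ) (s : ℂ)
    {S₁ S₂ : ℂ}
    (h₁ : HasSum (fun p : (qIdx a × ℕ) × ℕ => zetaTerm q sv p.1.1.1 *
        (zetaFactor q (p.1.1.last + p.1.2 + 1) (s - (b + 1 : ℕ)) *
          ((qratio q (p.2 + 1) - qratio q (p.1.1.last + p.1.2 + 1 + p.2 + 1) : ℝ) : ℂ)) *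
        (consecHomog (qratio q) b (p.2 + 1) (p.1.1.last + p.1.2 + 1 + 1) : ℂ)) S₁)
    (h₂ : HasSum (fun p : (qIdx a × ℕ) × ℕ => zetaTerm q sv p.1.1.1 *
        (zetaFactor q (p.1.1.last + p.1.2 + 1 + p.2 + 1) (s - (b + 1 : ℕ)) *
          (qratio q (p.2 + 1) : ℂ)) *
        (consecHomog (qratio q) b (p.2 + 1) (p.1.1.last + p.1.2 + 1 + 1) : ℂ)) S₂) :
    HasSum (GqTerm q (b + 1) sv s) (S₁ - S₂) := by
  have h₁' : HasSum (fun p : qIdx a × ℕ => zetaTerm q sv p.1.1 *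
      zetaFactor q (p.1.last + p.2 + 1) (s - (b + 1 : ℕ)) *
      (consecHomog (qratio q) (b + 1) 1 (p.1.last + p.2 + 1) : ℂ)) S₁ := by
    refine h₁.prod_fiberwise fun p => ?_
    have h := hasSum_ofReal.2 (hasSum_sub_mul_consecHomog hq0 hq1 (qratio_nonneg hq0 hq1)
      (qratio_le_pow hq0 hq1) (fun i j hi => qratio_anti hq0 hq1 i j hi) b (p.1.last + p.2 + 1))
    refine HasSum.congr_fun (h.mul_left (zetaTerm q sv p.1.1 *
      zetaFactor q (p.1.last + p.2 + 1) (s - (b + 1 : ℕ)))) fun j => ?_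
    rw [show p.1.last + p.2 + 1 + j + 1 = j + 1 + (p.1.last + p.2 + 1) by ring]
    push_cast
    ring
  have h₂' : HasSum (fun p : qIdx a × ℕ => zetaTerm q sv p.1.1 *
      zetaFactor q (p.1.last + p.2 + 1) (s - (b + 1 : ℕ)) *
      ((consecHomog (qratio q) (b + 1) 1 (p.1.last + p.2 + 1) -
        consecHomog (qratio q) (b + 1) (p.2 + 1) (p.1.last + 1) : ℝ) : ℂ)) S₂ := by
    have hinj : Function.Injective (Prod.map (id : qIdx a → qIdx a) Nat.succ) :=
      Function.injective_id.prodMap Nat.succ_injective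
    rw [← hinj.hasSum_iff]
    · refine HasSum.congr_fun h₂.antidiagonal_fiberwise fun p => ?_
      have h := congrArg (fun t : ℝ => (t : ℂ))
        (sum_antidiagonal_mul_consecHomog (qratio q) b p.1.last p.2)
      simp only [ofReal_sum] at h
      have hd : ∀ d, p.1.last + (d + 1) + 1 = p.1.last + d + 2 := fun d => by ring
      simp only [Function.comp, Prod.map, id, Nat.succ_eq_add_one, hd]
      rw [← h, Finset.mul_sum]
      refine Finset.sum_congr rfl fun x hx => ?_
      rw [Finset.HasAntidiagonal.mem_antidiagonal] at hx
      rw [show p.1.last + x.1 + 1 + x.2 + 1 = p.1.last + p.2 + 2 by omega]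
      push_cast
      ring
    · rintro ⟨n, i⟩ hi
      cases i with
      | zero => simp
      | succ i => exact absurd ⟨(n, i), rfl⟩ hi
  refine HasSum.congr_fun (h₁'.sub h₂') fun p => ?_
  rw [GqTerm]
  push_cast
  ring

theorem GqSummable_and_hasSum_GqTerm (hq0 : 0 < q) (hq1 : q < 1) (b : ℕ) {a : ℕ}
    (sv : Fin a → ℂ) (s : ℂ) (hs : (b : ℝ) + 1 < s.re)
    (hsum : Summable (fun p : qIdx a × ℕ =>
      zetaTerm q sv p.1.1 * zetaFactor q (p.1.last + p.2 + 1) (s - b))) :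
    GqSummable q (b + 1) a sv s ∧ HasSum (GqTerm q b sv s) (Gq q (b + 1) a sv s) := by
  induction b generalizing a sv s with
  | zero =>
    simp only [Nat.cast_zero, sub_zero] at hsum
    have h : Summable (fun n : qIdx (a + 1) => zetaTerm q (Fin.snoc sv s) n.1) := by
      rw [← (qIdx.snocEquiv a).summable_iff]
      simpa only [Function.comp_def, zetaTerm_snocEquiv] using hsum
    refine ⟨by simpa only [GqSummable] using h, ?_⟩
    have h' := (qIdx.snocEquiv a).hasSum_iff.2 h.hasSum
    rw [zero_add, Gq, qMZF]
    refine HasSum.congr_fun h' fun p => ?_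
    simp only [GqTerm, Function.comp, zetaTerm_snocEquiv, Nat.cast_zero, sub_zero,
      consecHomog_zero, ofReal_one, mul_one]
  | succ b ih =>
    push_cast at hs
    obtain ⟨hc₁, S₁, hS₁, hV₁⟩ := exists_hasSum_Gq_shift hq0 hq1 (b := b) (fun sv s => ih sv s)
      sv (s - (b + 2)) 2 (by simp)
      (by convert hsum using 4; push_cast; ring)
      (X := fun N => s - N - (b + 2)) (Y := fun N => N + (b + 2))
      (fun N => by ring) (fun N => by ring)
    obtain ⟨hc₂, S₂, hS₂, hV₂⟩ := exists_hasSum_Gq_shift hq0 hq1 (b := b) (fun sv s => ih sv s)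
      sv 0 (s - b) (by simp only [sub_re, natCast_re]; linarith)
      (by convert hsum using 4; push_cast; ring)
      (X := fun N => -N) (Y := fun N => s + N)
      (fun N => by ring) (fun N => by ring)
    refine ⟨?_, ?_⟩
    · rw [GqSummable]
      exact ⟨hc₁, hc₂, hS₁.summable, hS₂.summable⟩
    · rw [Gq, hS₁.tsum_eq, hS₂.tsum_eq]
      refine hasSum_GqTerm_sub hq0 hq1 sv s ?_ ?_
      · refine HasSum.congr_fun hV₁ fun p => ?_
        rw [zetaFactor_mul_two hq0 hq1 (by omega)]
        rw [show s - (b + 2) + 1 = s - (b + 1 : ℕ) by push_cast; ring]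
      · refine HasSum.congr_fun hV₂ fun p => ?_
        rw [show s - (b : ℂ) = s - (b + 1 : ℕ) + 1 by push_cast; ring,
          zetaFactor_zero_mul hq0 hq1 (by omega)]

end Gq

lemma summable_zetaFactor {q : ℝ} (hq0 : 0 < q) (hq1 : q < 1) {s : ℂ} (hs : 1 < s.re) :
    Summable (fun j : ℕ => zetaFactor q (j + 1) s) := by
  have hr : q ^ (s.re - 1) < 1 := Real.rpow_lt_one hq0.le hq1 (by linarith)
  refine Summable.of_norm_bounded
    ((summable_nat_add_iff 1).2 (summable_geometric_of_lt_one (by positivity) hr)) fun j => ?_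
  rw [norm_zetaFactor hq0 hq1 (by omega)]
  calc (q ^ (j + 1))⁻¹ * qratio q (j + 1) ^ s.re
      ≤ (q ^ (j + 1))⁻¹ * (q ^ (j + 1)) ^ s.re := by
        gcongr
        · exact qratio_nonneg hq0 hq1 _
        · exact qratio_le_pow hq0 hq1 _
    _ = (q ^ (s.re - 1)) ^ (j + 1) := by
        rw [← Real.rpow_natCast (q ^ (s.re - 1)), ← Real.rpow_mul hq0.le, mul_comm (s.re - 1),
          Real.rpow_mul hq0.le, Real.rpow_natCast, Real.rpow_sub_one (by positivity),
          div_eq_inv_mul]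

instance : Unique (qIdx 0) where
  default := ⟨fun i => i.elim0, fun i => i.elim0, fun i => i.elim0⟩
  uniq _ := Subtype.ext (funext fun i => i.elim0)

/-- Sum formula for the `q`-multiple zeta function: for a positive integer `b` and
`Re(s) > b`, one has `G_q^{(0,b)}(s) = ζ_q(s)`, all the series occurring in the recursive
definition of `G_q^{(0,b)}(s)` being convergent. -/
theorem G_sum_formula (q : ℝ) (hq0 : 0 < q) (hq1 : q < 1)
    (b : ℕ) (hb : 1 ≤ b) (s : ℂ) (hs : (b : ℝ) < s.re) :
    GqSummable q b 0 (fun i => i.elim0) s ∧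
    Gq q b 0 (fun i => i.elim0) s = qMZF q (fun _ : Fin 1 => s) := by
  obtain ⟨b, rfl⟩ : ∃ c, b = c + 1 := ⟨b - 1, by omega⟩
  push_cast at hs
  have hterm (n : qIdx 0) : zetaTerm q (fun i : Fin 0 => (i.elim0 : ℂ)) n.1 = 1 := by
    simp [zetaTerm]
  have hlast (n : qIdx 0) : n.last = 0 := rfl
  have hsum (b : ℕ) (hs : (b : ℝ) + 1 < s.re) : Summable (fun p : qIdx 0 × ℕ =>
      zetaTerm q (fun i : Fin 0 => (i.elim0 : ℂ)) p.1.1 *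
        zetaFactor q (p.1.last + p.2 + 1) (s - b)) := by
    rw [← (Equiv.uniqueProd ℕ (qIdx 0)).symm.summable_iff]
    refine (summable_congr fun j => ?_).2 (summable_zetaFactor hq0 hq1 (s := s - b)
      (by simp only [sub_re, natCast_re]; linarith))
    simp [hterm, hlast]
  have h := GqSummable_and_hasSum_GqTerm hq0 hq1 b _ s hs (hsum b hs)
  have h0 := GqSummable_and_hasSum_GqTerm hq0 hq1 0 (fun i : Fin 0 => (i.elim0 : ℂ)) s
    (by have : (0 : ℝ) ≤ b := b.cast_nonneg
        push_cast
        linarith)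
    (hsum 0 (by have : (0 : ℝ) ≤ b := b.cast_nonneg
                push_cast
                linarith))
  refine ⟨h.1, ?_⟩
  have hζ : qMZF q (fun _ : Fin 1 => s) = Gq q 1 0 (fun i => i.elim0) s := by
    rw [Gq]
    have hsv : (fun _ : Fin 1 => s) = Fin.snoc (fun i : Fin 0 => (i.elim0 : ℂ)) s := by
      funext i
      rw [Subsingleton.elim i (Fin.last 0), Fin.snoc_last]
    rw [hsv]
  rw [hζ]
  refine h.2.unique ?_
  refine HasSum.congr_fun h0.2 fun p => ?_
  have := zetaFactor_add_natCast hq0 hq1 (show 1 ≤ p.2 + 1 by omega) (s - b) b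
  rw [sub_add_cancel] at this
  simp only [GqTerm, hterm, hlast, zero_add, consecHomog_one, Nat.cast_zero, sub_zero, this]
  push_cast
  ring
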